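/- arXiv:2410.13846 — 2 statements merged into one kernel-verified Lean document; each statement's English description precedes it below -/
import Mathlib

section
/- Let L_lip > 0 and let softmax : ℝ^d → ℝ^d be the map whose i-th entry is exp(x_i)/Σ_{j=1}^d exp(x_j). Then for any x, y ∈ ℝ^d, ‖softmax(x) − softmax(y)‖_1 ≤ 2‖x − y‖_∞, where ‖·‖_1 and ‖·‖_∞ are the ℓ1 and ℓ∞ norms on ℝ^d. -/
open scoped BigOperators

/-- The softmax map on `ℝ^d`: the `i`-th entry is `exp (x i) / ∑ j, exp (x j)`. -/
noncomputable def softmax {d : ℕ} (x : Fin d → ℝ) : Fin d → ℝ :=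
  fun i => Real.exp (x i) / ∑ j, Real.exp (x j)

/-- The ℓ¹ norm on `ℝ^d`. -/
noncomputable def l1norm {d : ℕ} (x : Fin d → ℝ) : ℝ := ∑ i, |x i|

/-- The ℓ∞ norm on `ℝ^d`. -/
noncomputable def linftynorm {d : ℕ} (x : Fin d → ℝ) : ℝ := ⨆ i, |x i|

theorem sub_le_of_odds_le {p q M : ℝ} (hp0 : 0 ≤ p) (hp1 : p ≤ 1) (hq0 : 0 ≤ q) (hq1 : q ≤ 1)
    (hM : 0 ≤ M) (h : p * (1 - q) ≤ Real.exp (2 * M) * (q * (1 - p))) : p - q ≤ M := by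
  by_contra! hlt
  have hpos : 0 < p * (1 - q) := mul_pos (by linarith) (by linarith)
  have hexp : 1 - (p - q) ≤ Real.exp (-(p - q)) := Real.one_sub_le_exp_neg _
  have hq : q ≤ p * Real.exp (-(p - q)) := by nlinarith
  have hp : 1 - p ≤ (1 - q) * Real.exp (-(p - q)) := by nlinarith
  have hmul : q * (1 - p) ≤ p * (1 - q) * Real.exp (-(2 * (p - q))) := by
    calc q * (1 - p) ≤ p * Real.exp (-(p - q)) * ((1 - q) * Real.exp (-(p - q))) :=
          mul_le_mul hq hp (by linarith) (by positivity)
      _ = p * (1 - q) * (Real.exp (-(p - q)) * Real.exp (-(p - q))) := by ring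
      _ = p * (1 - q) * Real.exp (-(2 * (p - q))) := by
          rw [← Real.exp_add]
          ring_nf
  have hcontr : p * (1 - q) ≤ p * (1 - q) * Real.exp (2 * M - 2 * (p - q)) := by
    calc p * (1 - q) ≤ Real.exp (2 * M) * (p * (1 - q) * Real.exp (-(2 * (p - q)))) :=
          h.trans (by gcongr)
      _ = p * (1 - q) * Real.exp (2 * M - 2 * (p - q)) := by
          rw [sub_eq_add_neg (2 * M), Real.exp_add]
          ring
  have hlt1 : Real.exp (2 * M - 2 * (p - q)) < 1 := Real.exp_lt_one_iff.mpr (by linarith)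
  nlinarith

theorem softmax_nonneg {d : ℕ} (x : Fin d → ℝ) (i : Fin d) : 0 ≤ softmax x i := by
  unfold softmax
  positivity

theorem sum_softmax {d : ℕ} [NeZero d] (x : Fin d → ℝ) : ∑ i, softmax x i = 1 := by
  have hpos : 0 < ∑ j, Real.exp (x j) :=
    Finset.sum_pos (fun j _ => Real.exp_pos _) Finset.univ_nonempty
  simp only [softmax]
  rw [← Finset.sum_div, div_self hpos.ne']

theorem softmax_mul_softmax_le {d : ℕ} {x y : Fin d → ℝ} {M : ℝ} (h : ∀ i, |x i - y i| ≤ M)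
    (i j : Fin d) :
    softmax x i * softmax y j ≤ Real.exp (2 * M) * (softmax y i * softmax x j) := by
  have hexp : Real.exp (x i) * Real.exp (y j)
      ≤ Real.exp (2 * M) * (Real.exp (y i) * Real.exp (x j)) := by
    simp only [← Real.exp_add]
    apply Real.exp_le_exp.mpr
    linarith [abs_le.mp (h i), abs_le.mp (h j)]
  simp only [softmax]
  rw [div_mul_div_comm, div_mul_div_comm, mul_comm (∑ k, Real.exp (y k)), ← mul_div_assoc]
  gcongr

theorem sum_softmax_sub_le {d : ℕ} [NeZero d] {x y : Fin d → ℝ} {M : ℝ}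
    (h : ∀ i, |x i - y i| ≤ M) (s : Finset (Fin d)) :
    ∑ i ∈ s, (softmax x i - softmax y i) ≤ M := by
  have hcompl (z : Fin d → ℝ) : 1 - ∑ i ∈ s, softmax z i = ∑ i ∈ sᶜ, softmax z i := by
    rw [← sum_softmax z, ← Finset.sum_add_sum_compl s, add_sub_cancel_left]
  have hnonneg (z : Fin d → ℝ) (t : Finset (Fin d)) : 0 ≤ ∑ i ∈ t, softmax z i :=
    Finset.sum_nonneg fun i _ => softmax_nonneg z i
  have hle (z : Fin d → ℝ) : ∑ i ∈ s, softmax z i ≤ 1 :=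
    sub_nonneg.mp (hcompl z ▸ hnonneg z sᶜ)
  rw [Finset.sum_sub_distrib]
  refine sub_le_of_odds_le (hnonneg x s) (hle x) (hnonneg y s) (hle y)
    ((abs_nonneg _).trans (h 0)) ?_
  rw [hcompl x, hcompl y, Finset.sum_mul_sum, Finset.sum_mul_sum, Finset.mul_sum]
  refine Finset.sum_le_sum fun i _ => ?_
  rw [Finset.mul_sum]
  exact Finset.sum_le_sum fun j _ => softmax_mul_softmax_le h i j

/-- `‖softmax x − softmax y‖₁ ≤ 2 ‖x − y‖_∞`. -/
theorem softmax_l1_lipschitz_linfty {d : ℕ} (L_lip : ℝ) (hL : 0 < L_lip)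
    (x y : Fin d → ℝ) :
    l1norm (softmax x - softmax y) ≤ 2 * linftynorm (x - y) := by
  rcases Nat.eq_zero_or_pos d with rfl | hd
  · simp [l1norm, linftynorm]
  have : NeZero d := ⟨hd.ne'⟩
  have hxy (i : Fin d) : |x i - y i| ≤ linftynorm (x - y) :=
    le_ciSup (f := fun i => |(x - y) i|) (Set.finite_range _).bddAbove i
  have hyx (i : Fin d) : |y i - x i| ≤ linftynorm (x - y) := abs_sub_comm (x i) (y i) ▸ hxy i
  let s : Finset (Fin d) := {i | softmax y i ≤ softmax x i}
  have hs : ∑ i ∈ s, |softmax x i - softmax y i| = ∑ i ∈ s, (softmax x i - softmax y i) :=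
    Finset.sum_congr rfl fun i hi => abs_of_nonneg (sub_nonneg.mpr (Finset.mem_filter.mp hi).2)
  have hsc : ∑ i ∈ sᶜ, |softmax x i - softmax y i| = ∑ i ∈ sᶜ, (softmax y i - softmax x i) := by
    refine Finset.sum_congr rfl fun i hi => ?_
    have hlt : softmax x i < softmax y i := by simpa [s] using hi
    rw [abs_of_neg (sub_neg.mpr hlt), neg_sub]
  simp only [l1norm, Pi.sub_apply]
  rw [← Finset.sum_add_sum_compl s, hs, hsc]
  linarith [sum_softmax_sub_le hxy s, sum_softmax_sub_le hyx sᶜ]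
end

section
/- Let H, N, d, d_k ∈ ℕ and B_X, B_Q, B_K, B_V > 0. For weights W_{Q,h}, W_{K,h} ∈ ℝ^{d×d_k} and W_{V,h} ∈ ℝ^{d×d} (h = 1,…,H) with ‖W_{Q,h}‖_F ≤ B_Q, ‖W_{K,h}‖_F ≤ B_K, ‖W_{V,h}‖_F ≤ B_V for all h, and any X, X̃ ∈ ℝ^{N×d} with ‖X‖_{2,∞} ≤ B_X and ‖X̃‖_{2,∞} ≤ B_X, the causal multi-head attention mha satisfies ‖mha(X, {W_{Q,h}, W_{K,h}, W_{V,h}}) − mha(X̃, {W_{Q,h}, W_{K,h}, W_{V,h}})‖_{2,∞} ≤ H·B_V·(1 + 4·B_X²·B_Q·B_K)·‖X − X̃‖_{2,∞}. -/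
open scoped BigOperators
open Matrix

/-- The Euclidean (ℓ²) norm on `ℝ^d`. -/
noncomputable def l2norm {d : ℕ} (x : Fin d → ℝ) : ℝ := Real.sqrt (∑ i, x i ^ 2)

/-- The ℓ_{2,∞} norm of a matrix: the maximum ℓ² norm of its rows. -/
noncomputable def norm2inf {N d : ℕ} (X : Matrix (Fin N) (Fin d) ℝ) : ℝ :=
  ⨆ i, l2norm (X i)

/-- The Frobenius norm of a matrix. -/
noncomputable def frobNorm {m n : ℕ} (A : Matrix (Fin m) (Fin n) ℝ) : ℝ :=
  Real.sqrt (∑ i, ∑ j, A i j ^ 2)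

/-- The causal attention matrix of a single head:
`[A]_{ij} = exp([X WQ WKᵀ Xᵀ]_{ij}) / ∑_{k ≤ i} exp([X WQ WKᵀ Xᵀ]_{ik})` for `j ≤ i`, and `0`
otherwise. -/
noncomputable def causalAttn {N d dk : ℕ} (X : Matrix (Fin N) (Fin d) ℝ)
    (WQ WK : Matrix (Fin d) (Fin dk) ℝ) : Matrix (Fin N) (Fin N) ℝ :=
  Matrix.of fun i j =>
    if j ≤ i then
      Real.exp ((X * WQ * (X * WK)ᵀ) i j) /
        ∑ k ∈ Finset.univ.filter (fun k : Fin N => k ≤ i),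
          Real.exp ((X * WQ * (X * WK)ᵀ) i k)
    else 0

/-- Causal multi-head attention: `mha(X) = ∑_h A_h X W_{V,h}`. -/
noncomputable def mha {N d dk H : ℕ} (X : Matrix (Fin N) (Fin d) ℝ)
    (WQ WK : Fin H → Matrix (Fin d) (Fin dk) ℝ)
    (WV : Fin H → Matrix (Fin d) (Fin d) ℝ) : Matrix (Fin N) (Fin d) ℝ :=
  ∑ h, causalAttn X (WQ h) (WK h) * X * WV h

lemma l2norm_eq_norm {d : ℕ} (x : Fin d → ℝ) : l2norm x = ‖WithLp.toLp 2 x‖ := by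
  simp [l2norm, EuclideanSpace.norm_eq]

lemma l2norm_nonneg {d : ℕ} (x : Fin d → ℝ) : 0 ≤ l2norm x := Real.sqrt_nonneg _

lemma l2norm_add_le {d : ℕ} (x y : Fin d → ℝ) : l2norm (x + y) ≤ l2norm x + l2norm y := by
  simp only [l2norm_eq_norm, WithLp.toLp_add]
  exact norm_add_le _ _

lemma l2norm_smul {d : ℕ} (c : ℝ) (x : Fin d → ℝ) : l2norm (c • x) = |c| * l2norm x := by
  simp only [l2norm_eq_norm, WithLp.toLp_smul, norm_smul, Real.norm_eq_abs]

lemma l2norm_sum_le {ι : Type*} {d : ℕ} (s : Finset ι) (f : ι → Fin d → ℝ) :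
    l2norm (∑ i ∈ s, f i) ≤ ∑ i ∈ s, l2norm (f i) := by
  simp only [l2norm_eq_norm, WithLp.toLp_sum]
  exact norm_sum_le _ _

lemma abs_dotProduct_le {d : ℕ} (x y : Fin d → ℝ) : |x ⬝ᵥ y| ≤ l2norm x * l2norm y := by
  rw [l2norm, l2norm, ← Real.sqrt_mul (Finset.sum_nonneg fun i _ => sq_nonneg (x i))]
  exact Real.abs_le_sqrt (Finset.sum_mul_sq_le_sq_mul_sq _ _ _)

lemma l2norm_vecMul_le {m n : ℕ} (x : Fin m → ℝ) (W : Matrix (Fin m) (Fin n) ℝ) :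
    l2norm (x ᵥ* W) ≤ l2norm x * frobNorm W := by
  rw [l2norm, l2norm, frobNorm, ← Real.sqrt_mul (Finset.sum_nonneg fun i _ => sq_nonneg (x i)),
    Finset.sum_comm (f := fun i j => W i j ^ 2), Finset.mul_sum]
  exact Real.sqrt_le_sqrt (Finset.sum_le_sum fun j _ =>
    Finset.sum_mul_sq_le_sq_mul_sq Finset.univ x fun i => W i j)

lemma l2norm_row_le_norm2inf {N d : ℕ} (X : Matrix (Fin N) (Fin d) ℝ) (i : Fin N) :
    l2norm (X i) ≤ norm2inf X :=
  le_ciSup (f := fun i => l2norm (X i)) (Set.finite_range _).bddAbove i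

lemma norm2inf_nonneg {N d : ℕ} (X : Matrix (Fin N) (Fin d) ℝ) : 0 ≤ norm2inf X :=
  Real.iSup_nonneg fun _ => l2norm_nonneg _

lemma sq_sub_div_add_le {p q : ℝ} (hp : 0 < p) (hq : 0 < q) :
    (p - q) ^ 2 / (p + q) ≤ (p - q) * (Real.log p - Real.log q) := by
  wlog h : q ≤ p generalizing p q
  · have := this hq hp (le_of_not_ge h)
    rw [add_comm q p] at this
    linarith [show (q - p) ^ 2 / (p + q) = (p - q) ^ 2 / (p + q) by ring]
  have hlog : (p - q) / p ≤ Real.log p - Real.log q := by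
    have h1 := Real.one_sub_inv_le_log_of_pos (div_pos hp hq)
    rw [Real.log_div hp.ne' hq.ne', inv_div] at h1
    rwa [sub_div, div_self hp.ne']
  calc (p - q) ^ 2 / (p + q) ≤ (p - q) ^ 2 / p := by
        gcongr; linarith
    _ = (p - q) * ((p - q) / p) := by ring
    _ ≤ _ := mul_le_mul_of_nonneg_left hlog (by linarith)

/-- The softmax map is `2`-Lipschitz from the `ℓ^∞` norm to the `ℓ^1` norm. -/
lemma sum_abs_softmax_sub_le {ι : Type*} (S : Finset ι) (hS : S.Nonempty) (s t : ι → ℝ) (ε : ℝ)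
    (h : ∀ j ∈ S, |s j - t j| ≤ ε) :
    ∑ j ∈ S, |Real.exp (s j) / ∑ k ∈ S, Real.exp (s k) -
      Real.exp (t j) / ∑ k ∈ S, Real.exp (t k)| ≤ 2 * ε := by
  have hZ : 0 < ∑ k ∈ S, Real.exp (s k) := Finset.sum_pos (fun _ _ => Real.exp_pos _) hS
  have hZ' : 0 < ∑ k ∈ S, Real.exp (t k) := Finset.sum_pos (fun _ _ => Real.exp_pos _) hS
  set Z := ∑ k ∈ S, Real.exp (s k) with hZdef
  set Z' := ∑ k ∈ S, Real.exp (t k) with hZ'def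
  set p : ι → ℝ := fun j => Real.exp (s j) / Z with hp
  set q : ι → ℝ := fun j => Real.exp (t j) / Z' with hq
  have hp0 (j) : 0 < p j := div_pos (Real.exp_pos _) hZ
  have hq0 (j) : 0 < q j := div_pos (Real.exp_pos _) hZ'
  have hp1 : ∑ j ∈ S, p j = 1 := by
    rw [hp, ← Finset.sum_div, ← hZdef, div_self hZ.ne']
  have hq1 : ∑ j ∈ S, q j = 1 := by
    rw [hq, ← Finset.sum_div, ← hZ'def, div_self hZ'.ne']
  change ∑ j ∈ S, |p j - q j| ≤ 2 * ε
  set T := ∑ j ∈ S, |p j - q j| with hT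
  have hT0 : 0 ≤ T := Finset.sum_nonneg fun _ _ => abs_nonneg _
  have hcs : T ^ 2 / 2 ≤ ∑ j ∈ S, (p j - q j) ^ 2 / (p j + q j) := by
    have := Finset.sq_sum_div_le_sum_sq_div S (fun j => |p j - q j|)
      (g := fun j => p j + q j) fun j _ => add_pos (hp0 j) (hq0 j)
    simpa only [sq_abs, Finset.sum_add_distrib, hp1, hq1, one_add_one_eq_two] using this
  have hlog : ∑ j ∈ S, (p j - q j) * (Real.log (p j) - Real.log (q j)) =
      ∑ j ∈ S, (p j - q j) * (s j - t j) := by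
    have hj (j) : (p j - q j) * (Real.log (p j) - Real.log (q j)) =
        (p j - q j) * (s j - t j) + (p j - q j) * (Real.log Z' - Real.log Z) := by
      rw [show Real.log (p j) = s j - Real.log Z by
          rw [hp, Real.log_div (Real.exp_pos _).ne' hZ.ne', Real.log_exp],
        show Real.log (q j) = t j - Real.log Z' by
          rw [hq, Real.log_div (Real.exp_pos _).ne' hZ'.ne', Real.log_exp]]
      ring
    rw [Finset.sum_congr rfl fun j _ => hj j, Finset.sum_add_distrib, ← Finset.sum_mul,
      Finset.sum_sub_distrib, hp1, hq1]
    ring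
  have hup : ∑ j ∈ S, (p j - q j) * (s j - t j) ≤ T * ε := by
    rw [hT, Finset.sum_mul]
    refine Finset.sum_le_sum fun j hj => (le_abs_self _).trans ?_
    rw [abs_mul]
    exact mul_le_mul_of_nonneg_left (h j hj) (abs_nonneg _)
  have hmid : ∑ j ∈ S, (p j - q j) ^ 2 / (p j + q j) ≤
      ∑ j ∈ S, (p j - q j) * (Real.log (p j) - Real.log (q j)) :=
    Finset.sum_le_sum fun j _ => sq_sub_div_add_le (hp0 j) (hq0 j)
  have hε : 0 ≤ ε := hS.elim fun j hj => (abs_nonneg _).trans (h j hj)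
  by_contra! hlt
  nlinarith

lemma causalAttn_nonneg {N d dk : ℕ} (X : Matrix (Fin N) (Fin d) ℝ)
    (WQ WK : Matrix (Fin d) (Fin dk) ℝ) (i j : Fin N) : 0 ≤ causalAttn X WQ WK i j := by
  simp only [causalAttn, Matrix.of_apply]
  split_ifs
  · positivity
  · exact le_rfl

lemma sum_causalAttn {N d dk : ℕ} (X : Matrix (Fin N) (Fin d) ℝ)
    (WQ WK : Matrix (Fin d) (Fin dk) ℝ) (i : Fin N) : ∑ j, causalAttn X WQ WK i j = 1 := by
  simp only [causalAttn, Matrix.of_apply]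
  rw [← Finset.sum_filter, ← Finset.sum_div]
  exact div_self (Finset.sum_pos (fun _ _ => Real.exp_pos _) ⟨i, by simp⟩).ne'

lemma abs_score_sub_le {d dk : ℕ} {B_X B_Q B_K δ : ℝ}
    {WQ WK : Matrix (Fin d) (Fin dk) ℝ} (hWQ : frobNorm WQ ≤ B_Q) (hWK : frobNorm WK ≤ B_K)
    {x x' y y' : Fin d → ℝ} (hx' : l2norm x' ≤ B_X) (hy : l2norm y ≤ B_X)
    (hx : l2norm (x - x') ≤ δ) (hyy : l2norm (y - y') ≤ δ) :
    |(x ᵥ* WQ) ⬝ᵥ (y ᵥ* WK) - (x' ᵥ* WQ) ⬝ᵥ (y' ᵥ* WK)| ≤ 2 * B_X * B_Q * B_K * δ := by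
  have hbound (u v : Fin d → ℝ) {a b : ℝ} (hu : l2norm u ≤ a) (hv : l2norm v ≤ b) :
      |(u ᵥ* WQ) ⬝ᵥ (v ᵥ* WK)| ≤ (a * B_Q) * (b * B_K) := by
    have ha := (l2norm_nonneg u).trans hu
    have hb := (l2norm_nonneg v).trans hv
    have hQ : 0 ≤ frobNorm WQ := Real.sqrt_nonneg _
    have hK : 0 ≤ frobNorm WK := Real.sqrt_nonneg _
    exact (abs_dotProduct_le _ _).trans (mul_le_mul
      ((l2norm_vecMul_le u WQ).trans (mul_le_mul hu hWQ hQ ha))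
      ((l2norm_vecMul_le v WK).trans (mul_le_mul hv hWK hK hb))
      (l2norm_nonneg _) (mul_nonneg ha (hQ.trans hWQ)))
  have hsplit : (x ᵥ* WQ) ⬝ᵥ (y ᵥ* WK) - (x' ᵥ* WQ) ⬝ᵥ (y' ᵥ* WK) =
      ((x - x') ᵥ* WQ) ⬝ᵥ (y ᵥ* WK) + (x' ᵥ* WQ) ⬝ᵥ ((y - y') ᵥ* WK) := by
    simp only [Matrix.sub_vecMul, sub_dotProduct, dotProduct_sub]
    ring
  rw [hsplit]
  calc _ ≤ _ := abs_add_le _ _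
    _ ≤ (δ * B_Q) * (B_X * B_K) + (B_X * B_Q) * (δ * B_K) :=
      add_le_add (hbound _ _ hx hy) (hbound _ _ hx' hyy)
    _ = _ := by ring

lemma sum_abs_causalAttn_sub_le {N d dk : ℕ} {B_X B_Q B_K : ℝ}
    {WQ WK : Matrix (Fin d) (Fin dk) ℝ} (hWQ : frobNorm WQ ≤ B_Q) (hWK : frobNorm WK ≤ B_K)
    {X X' : Matrix (Fin N) (Fin d) ℝ} (hX : norm2inf X ≤ B_X) (hX' : norm2inf X' ≤ B_X)
    (i : Fin N) :
    ∑ j, |causalAttn X WQ WK i j - causalAttn X' WQ WK i j| ≤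
      4 * B_X * B_Q * B_K * norm2inf (X - X') := by
  have key := sum_abs_softmax_sub_le (Finset.univ.filter (fun k : Fin N => k ≤ i)) ⟨i, by simp⟩
    ((X * WQ * (X * WK)ᵀ) i) ((X' * WQ * (X' * WK)ᵀ) i)
    (2 * B_X * B_Q * B_K * norm2inf (X - X')) fun j _ =>
      abs_score_sub_le hWQ hWK ((l2norm_row_le_norm2inf X' i).trans hX')
        ((l2norm_row_le_norm2inf X j).trans hX) (l2norm_row_le_norm2inf (X - X') i)
        (l2norm_row_le_norm2inf (X - X') j)
  rw [Finset.sum_filter] at key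
  calc _ = _ := Finset.sum_congr rfl fun j _ => by
        simp only [causalAttn, Matrix.of_apply]
        split_ifs
        · rfl
        · simp
    _ ≤ _ := key
    _ = _ := by ring

lemma l2norm_causalAttn_mul_sub_le {N d dk : ℕ} {B_X B_Q B_K : ℝ} (hBX : 0 ≤ B_X)
    {WQ WK : Matrix (Fin d) (Fin dk) ℝ} (hWQ : frobNorm WQ ≤ B_Q) (hWK : frobNorm WK ≤ B_K)
    {X X' : Matrix (Fin N) (Fin d) ℝ} (hX : norm2inf X ≤ B_X) (hX' : norm2inf X' ≤ B_X)
    (i : Fin N) :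
    l2norm ((causalAttn X WQ WK * X - causalAttn X' WQ WK * X') i) ≤
      (1 + 4 * B_X ^ 2 * B_Q * B_K) * norm2inf (X - X') := by
  set A := causalAttn X WQ WK
  set A' := causalAttn X' WQ WK
  have hsplit : (A * X - A' * X') i =
      ∑ j, A i j • (X - X') j + ∑ j, (A i j - A' i j) • X' j := by
    ext l
    simp only [Matrix.sub_apply, Matrix.mul_apply, Pi.add_apply, Finset.sum_apply, Pi.smul_apply,
      smul_eq_mul, ← Finset.sum_sub_distrib, ← Finset.sum_add_distrib]
    exact Finset.sum_congr rfl fun j _ => by ring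
  have h1 : l2norm (∑ j, A i j • (X - X') j) ≤ norm2inf (X - X') := by
    calc _ ≤ _ := l2norm_sum_le _ _
      _ ≤ ∑ j, A i j * norm2inf (X - X') := Finset.sum_le_sum fun j _ => by
        rw [l2norm_smul, abs_of_nonneg (causalAttn_nonneg ..)]
        exact mul_le_mul_of_nonneg_left (l2norm_row_le_norm2inf _ j) (causalAttn_nonneg ..)
      _ = _ := by rw [← Finset.sum_mul, sum_causalAttn, one_mul]
  have h2 : l2norm (∑ j, (A i j - A' i j) • X' j) ≤
      (4 * B_X * B_Q * B_K * norm2inf (X - X')) * B_X := by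
    calc _ ≤ _ := l2norm_sum_le _ _
      _ ≤ ∑ j, |A i j - A' i j| * B_X := Finset.sum_le_sum fun j _ => by
        rw [l2norm_smul]
        exact mul_le_mul_of_nonneg_left ((l2norm_row_le_norm2inf _ j).trans hX') (abs_nonneg _)
      _ ≤ _ := by
        rw [← Finset.sum_mul]
        exact mul_le_mul_of_nonneg_right (sum_abs_causalAttn_sub_le hWQ hWK hX hX' i) hBX
  rw [hsplit]
  calc _ ≤ _ := l2norm_add_le _ _
    _ ≤ _ := add_le_add h1 h2
    _ = _ := by ring

/-- Lipschitz property of causal multi-head attention in the ℓ_{2,∞} norm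
(Lemma I.8 of Zhang et al.). -/
theorem mha_lipschitz {H N d dk : ℕ} (B_X B_Q B_K B_V : ℝ)
    (hBX : 0 < B_X) (hBQ : 0 < B_Q) (hBK : 0 < B_K) (hBV : 0 < B_V)
    (WQ WK : Fin H → Matrix (Fin d) (Fin dk) ℝ)
    (WV : Fin H → Matrix (Fin d) (Fin d) ℝ)
    (hWQ : ∀ h, frobNorm (WQ h) ≤ B_Q)
    (hWK : ∀ h, frobNorm (WK h) ≤ B_K)
    (hWV : ∀ h, frobNorm (WV h) ≤ B_V)
    (X X' : Matrix (Fin N) (Fin d) ℝ)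
    (hX : norm2inf X ≤ B_X) (hX' : norm2inf X' ≤ B_X) :
    norm2inf (mha X WQ WK WV - mha X' WQ WK WV) ≤
      H * B_V * (1 + 4 * B_X ^ 2 * B_Q * B_K) * norm2inf (X - X') := by
  have hL : 0 ≤ (1 + 4 * B_X ^ 2 * B_Q * B_K) * norm2inf (X - X') :=
    mul_nonneg (by positivity) (norm2inf_nonneg _)
  have hrow (i : Fin N) : (mha X WQ WK WV - mha X' WQ WK WV) i =
      ∑ h, ((causalAttn X (WQ h) (WK h) * X - causalAttn X' (WQ h) (WK h) * X') i) ᵥ* WV h := by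
    rw [mha, mha, ← Finset.sum_sub_distrib]
    simp only [← Matrix.sub_mul]
    ext l
    rw [Matrix.sum_apply, Finset.sum_apply]
    rfl
  refine Real.iSup_le (fun i => ?_) ?_
  · rw [hrow]
    calc _ ≤ _ := l2norm_sum_le _ _
      _ ≤ ∑ _h : Fin H, (1 + 4 * B_X ^ 2 * B_Q * B_K) * norm2inf (X - X') * B_V :=
        Finset.sum_le_sum fun h _ => (l2norm_vecMul_le _ _).trans
          (mul_le_mul (l2norm_causalAttn_mul_sub_le hBX.le (hWQ h) (hWK h) hX hX' i) (hWV h)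
            (Real.sqrt_nonneg _) hL)
      _ = _ := by
        rw [Finset.sum_const, Finset.card_univ, Fintype.card_fin, nsmul_eq_mul]
        ring
  · rw [mul_assoc]
    exact mul_nonneg (by positivity) hL
end
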